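/- Let n ≥ 1, 0 < γ < 1, and define σ(ξ, η) = |ξ|^γ + |η|^γ − |ξ+η|^γ for ξ, η ∈ ℝⁿ. For every integer m ≥ 1 and every multi-index α there exists a constant C = C(α, γ, m, n) > 0 such that for all ξ, η ∈ ℝⁿ with 0 < |ξ| ≤ 1/100 and 1/2 ≤ |η| ≤ 2: |∂_ξ^α (σ(ξ, η)^{−m})| ≤ C · |ξ|^{−mγ−|α|}. -/

import Mathlib

open Set Finset

theorem one_sub_mul_rpow_le_phase {E : Type*} [SeminormedAddCommGroup E] {γ : ℝ} (hγ0 : 0 < γ)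
    (hγ1 : γ < 1) {ξ η : E} (hξ : 0 < ‖ξ‖) (h : ‖ξ‖ ≤ ‖η‖) :
    (1 - γ) * ‖ξ‖ ^ γ ≤ ‖ξ‖ ^ γ + ‖η‖ ^ γ - ‖ξ + η‖ ^ γ := by
  have hη : 0 < ‖η‖ := hξ.trans_le h
  have hadd : ‖ξ + η‖ ^ γ ≤ ‖η‖ ^ γ * (1 + γ * (‖ξ‖ / ‖η‖)) := calc
    ‖ξ + η‖ ^ γ ≤ (‖η‖ * (1 + ‖ξ‖ / ‖η‖)) ^ γ := by
        gcongr
        rw [mul_add, mul_div_cancel₀ _ hη.ne', mul_one, add_comm ξ]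
        exact norm_add_le η ξ
    _ = ‖η‖ ^ γ * (1 + ‖ξ‖ / ‖η‖) ^ γ := Real.mul_rpow hη.le (by positivity)
    _ ≤ _ := by
        gcongr
        exact rpow_one_add_le_one_add_mul_self
          (by linarith [div_nonneg hξ.le hη.le]) hγ0.le hγ1.le
  have hratio : ‖ξ‖ / ‖η‖ ≤ (‖ξ‖ / ‖η‖) ^ γ :=
    Real.self_le_rpow_of_le_one (by positivity) ((div_le_one hη).2 h) hγ1.le
  have hmul : ‖η‖ ^ γ * (‖ξ‖ / ‖η‖) ≤ ‖ξ‖ ^ γ := by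
    calc _ ≤ ‖η‖ ^ γ * (‖ξ‖ / ‖η‖) ^ γ := by gcongr
      _ = ‖ξ‖ ^ γ := by
        rw [← Real.mul_rpow hη.le (by positivity), mul_div_cancel₀ _ hη.ne']
  nlinarith

section PowerOfNorm

variable {E : Type*} [NormedAddCommGroup E] [InnerProductSpace ℝ E]

theorem contDiffAt_norm_rpow {x : E} (hx : x ≠ 0) (p : ℝ) (N : WithTop ℕ∞) :
    ContDiffAt ℝ N (fun y : E => ‖y‖ ^ p) x :=
  (contDiffAt_norm ℝ hx).rpow_const_of_ne (norm_ne_zero_iff.2 hx)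

theorem exists_norm_iteratedFDeriv_norm_rpow_le [FiniteDimensional ℝ E] (p : ℝ) (i : ℕ) :
    ∃ M : ℝ, 0 ≤ M ∧ ∀ x : E, x ≠ 0 →
      ‖iteratedFDeriv ℝ i (fun y : E => ‖y‖ ^ p) x‖ ≤ M * ‖x‖ ^ (p - i) := by
  have hcont : ContinuousOn (iteratedFDeriv ℝ i (fun y : E => ‖y‖ ^ p)) (Metric.sphere 0 1) :=
    fun x hx => ((contDiffAt_norm_rpow (ne_zero_of_mem_unit_sphere ⟨x, hx⟩) p i)
      |>.continuousAt_iteratedFDeriv le_rfl).continuousWithinAt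
  obtain ⟨M, hM⟩ := (isCompact_sphere (0 : E) 1).exists_bound_of_continuousOn hcont
  refine ⟨max M 0, le_max_right _ _, fun x hx => ?_⟩
  have hr : 0 < ‖x‖ := norm_pos_iff.2 hx
  set r := ‖x‖ with hrdef
  have hu : r⁻¹ ≠ 0 := inv_ne_zero hr.ne'
  let L : E ≃L[ℝ] E := ContinuousLinearEquiv.smulLeft (Units.mk0 r⁻¹ hu)
  have hL : ∀ y, L y = r⁻¹ • y := fun y => rfl
  have hLx : L x ≠ 0 := by simpa using hx
  have hLnorm : ‖(L : E →L[ℝ] E)‖ ≤ r⁻¹ := by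
    refine ContinuousLinearMap.opNorm_le_bound _ (inv_nonneg.2 hr.le) fun y => ?_
    simp [hL, norm_smul, abs_of_pos hr]
  have hfun : (fun y : E => ‖y‖ ^ p) = r ^ p • ((fun y : E => ‖y‖ ^ p) ∘ L) := by
    ext y
    simp only [Pi.smul_apply, Function.comp, hL, norm_smul, smul_eq_mul, norm_inv, Real.norm_eq_abs,
      abs_of_pos hr]
    rw [← Real.mul_rpow hr.le (by positivity), mul_inv_cancel_left₀ hr.ne']
  have hcomp : iteratedFDeriv ℝ i ((fun y : E => ‖y‖ ^ p) ∘ L) x =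
      (iteratedFDeriv ℝ i (fun y : E => ‖y‖ ^ p) (L x)).compContinuousLinearMap fun _ => L := by
    simpa only [preimage_univ, iteratedFDerivWithin_univ] using
      L.iteratedFDerivWithin_comp_right (fun y : E => ‖y‖ ^ p) uniqueDiffOn_univ (mem_univ (L x)) i
  have hsphere : L x ∈ Metric.sphere (0 : E) 1 := by
    simp [hL, norm_smul, abs_of_pos hr, ← hrdef, hr.ne']
  rw [hfun, iteratedFDeriv_const_smul_apply
    ((contDiffAt_norm_rpow hLx p i).comp x L.contDiff.contDiffAt), norm_smul, hcomp,
    Real.norm_of_nonneg (by positivity)]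
  calc r ^ p * ‖(iteratedFDeriv ℝ i (fun y : E => ‖y‖ ^ p) (L x)).compContinuousLinearMap
          fun _ => (L : E →L[ℝ] E)‖
      ≤ r ^ p * (max M 0 * r⁻¹ ^ i) := by
        gcongr
        refine (ContinuousMultilinearMap.norm_compContinuousLinearMap_le _ _).trans ?_
        rw [prod_const, card_univ, Fintype.card_fin]
        gcongr
        exact (hM _ hsphere).trans (le_max_left _ _)
    _ = max M 0 * r ^ (p - i) := by
        rw [Real.rpow_sub hr, Real.rpow_natCast, inv_pow]
        ring

/-- The derivatives of `σ(·,η)` of positive order obey the same bounds as those of `‖·‖ ^ γ`. -/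
theorem exists_norm_iteratedFDeriv_phase_le [FiniteDimensional ℝ E] {γ : ℝ} (hγ1 : γ < 1) (i : ℕ) :
    ∃ M : ℝ, 0 ≤ M ∧ ∀ ξ η : E, 1 ≤ i → 0 < ‖ξ‖ → ‖ξ‖ ≤ ‖ξ + η‖ →
      ‖iteratedFDeriv ℝ i (fun x : E => ‖x‖ ^ γ + ‖η‖ ^ γ - ‖x + η‖ ^ γ) ξ‖ ≤
        M * ‖ξ‖ ^ (γ - i) := by
  obtain ⟨M, hM0, hM⟩ := exists_norm_iteratedFDeriv_norm_rpow_le (E := E) γ i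
  refine ⟨2 * M, by positivity, fun ξ η hi hξ hle => ?_⟩
  have hi' : (1 : ℝ) ≤ i := by exact_mod_cast hi
  have hξ0 : ξ ≠ 0 := norm_pos_iff.1 hξ
  have hξη : ξ + η ≠ 0 := norm_pos_iff.1 (hξ.trans_le hle)
  have h₁ : ContDiffAt ℝ i (fun x : E => ‖x‖ ^ γ) ξ := contDiffAt_norm_rpow hξ0 γ i
  have h₂ : ContDiffAt ℝ i (fun x : E => ‖x + η‖ ^ γ) ξ :=
    (contDiffAt_norm_rpow hξη γ i).comp ξ (contDiffAt_id.add contDiffAt_const)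
  have hc : ContDiffAt ℝ i (fun _ : E => ‖η‖ ^ γ) ξ := contDiffAt_const
  have hsplit : iteratedFDeriv ℝ i (fun x : E => ‖x‖ ^ γ + ‖η‖ ^ γ - ‖x + η‖ ^ γ) ξ =
      iteratedFDeriv ℝ i (fun x : E => ‖x‖ ^ γ) ξ -
        iteratedFDeriv ℝ i (fun x : E => ‖x‖ ^ γ) (ξ + η) := by
    rw [← iteratedFDeriv_comp_add_right]
    rw [fun_iteratedFDeriv_sub_apply (h₁.add hc) h₂, fun_iteratedFDeriv_add_apply h₁ hc,
      iteratedFDeriv_const_of_ne (by lia), Pi.zero_apply, add_zero]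
  rw [hsplit]
  calc _ ≤ M * ‖ξ‖ ^ (γ - i) + M * ‖ξ + η‖ ^ (γ - i) :=
        (norm_sub_le _ _).trans (add_le_add (hM ξ hξ0) (hM _ hξη))
    _ ≤ M * ‖ξ‖ ^ (γ - i) + M * ‖ξ‖ ^ (γ - i) := by
        gcongr M * ‖ξ‖ ^ (γ - i) + M * ?_
        exact Real.rpow_le_rpow_of_nonpos hξ hle (by linarith)
    _ = 2 * M * ‖ξ‖ ^ (γ - i) := by ring

end PowerOfNorm

theorem exists_norm_iteratedFDeriv_zpow_neg_le (m k : ℕ) {c : ℝ} (hc : 0 < c) :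
    ∃ C : ℝ, 0 < C ∧ ∀ t : ℝ, c ≤ t → ∀ i ≤ k,
      ‖iteratedFDeriv ℝ i (fun s : ℝ => s ^ (-(m : ℤ))) t‖ ≤ C := by
  let B : ℕ → ℝ := fun i => |∏ j ∈ range i, (((-(m : ℤ) : ℤ) : ℝ) - j)| * (c ^ (m + i))⁻¹
  have hB : ∀ i, 0 ≤ B i := fun i => by positivity
  refine ⟨1 + ∑ i ∈ range (k + 1), B i,
    by linarith [sum_nonneg fun i (_ : i ∈ range (k + 1)) => hB i], fun t ht i hi => ?_⟩
  have ht0 : 0 < t := hc.trans_le ht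
  have hzpow : t ^ (-(m : ℤ) - i) = (t ^ (m + i))⁻¹ := by
    rw [← zpow_natCast, ← zpow_neg]
    congr 1
    push_cast
    ring
  calc ‖iteratedFDeriv ℝ i (fun s : ℝ => s ^ (-(m : ℤ))) t‖
      = |∏ j ∈ range i, (((-(m : ℤ) : ℤ) : ℝ) - j)| * (t ^ (m + i))⁻¹ := by
        rw [norm_iteratedFDeriv_eq_norm_iteratedDeriv, iteratedDeriv_eq_iterate, iter_deriv_zpow,
          norm_mul, Real.norm_eq_abs, hzpow, Real.norm_of_nonneg (by positivity)]
    _ ≤ B i := by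
        dsimp only [B]
        gcongr
    _ ≤ ∑ i ∈ range (k + 1), B i :=
        single_le_sum (fun i _ => hB i) (mem_range.2 (by lia))
    _ ≤ _ := by linarith

/-- Symbol estimates for negative powers of `σ(ξ,η) = |ξ|^γ + |η|^γ - |ξ+η|^γ` in the regime
`0 < |ξ| ≤ 1/100`, `1/2 ≤ |η| ≤ 2`: the derivatives of order `k` in `ξ` of `σ^{-m}` are
bounded by `C |ξ|^{-mγ-k}`. -/
theorem phase_symbol_inverse_power_derivative_bound
    (n : ℕ) (hn : 1 ≤ n) (γ : ℝ) (hγ0 : 0 < γ) (hγ1 : γ < 1)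
    (m : ℕ) (hm : 1 ≤ m) (k : ℕ) :
    ∃ C : ℝ, 0 < C ∧
      ∀ ξ η : EuclideanSpace ℝ (Fin n),
        0 < ‖ξ‖ → ‖ξ‖ ≤ 1 / 100 → 1 / 2 ≤ ‖η‖ → ‖η‖ ≤ 2 →
        ‖iteratedFDeriv ℝ k
            (fun ξ' : EuclideanSpace ℝ (Fin n) =>
              (‖ξ'‖ ^ γ + ‖η‖ ^ γ - ‖ξ' + η‖ ^ γ) ^ (-(m : ℤ))) ξ‖ ≤
          C * ‖ξ‖ ^ (-(m : ℝ) * γ - (k : ℝ)) := by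
  choose M hM0 hM using exists_norm_iteratedFDeriv_phase_le (E := EuclideanSpace ℝ (Fin n)) hγ1
  obtain ⟨C, hC0, hC⟩ := exists_norm_iteratedFDeriv_zpow_neg_le m k (sub_pos.2 hγ1)
  set D : ℝ := 1 + ∑ i ∈ range (k + 1), M i
  have hD1 : 1 ≤ D := by linarith [sum_nonneg fun i (_ : i ∈ range (k + 1)) => hM0 i]
  have hD : ∀ i, 1 ≤ i → i ≤ k → M i ≤ D ^ i := fun i hi hik => by
    have hle : M i ≤ ∑ i ∈ range (k + 1), M i :=
      single_le_sum (fun i _ => hM0 i) (mem_range.2 (by lia))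
    linarith [le_self_pow₀ hD1 (show i ≠ 0 by lia)]
  refine ⟨k.factorial * C * D ^ k, by positivity, fun ξ η hξ hξ' hη _ => ?_⟩
  have hξη : ‖ξ‖ ≤ ‖ξ + η‖ := by
    have := norm_sub_le (ξ + η) ξ
    rw [add_sub_cancel_left] at this
    linarith
  set r := ‖ξ‖
  set σ : EuclideanSpace ℝ (Fin n) → ℝ := fun x => ‖x‖ ^ γ + ‖η‖ ^ γ - ‖x + η‖ ^ γ with hσ
  set f : EuclideanSpace ℝ (Fin n) → ℝ := (r ^ γ)⁻¹ • σ with hf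
  have hrγ : 0 < r ^ γ := Real.rpow_pos_of_pos hξ γ
  have hfξ : 1 - γ ≤ f ξ := by
    rw [hf, Pi.smul_apply, smul_eq_mul, inv_mul_eq_div, le_div_iff₀ hrγ]
    exact one_sub_mul_rpow_le_phase hγ0 hγ1 hξ (by linarith)
  have hσdiff : ∀ x, x ≠ 0 → x + η ≠ 0 → ContDiffAt ℝ k σ x := fun x hx hxη =>
    ((contDiffAt_norm_rpow hx γ k).add contDiffAt_const).sub
      ((contDiffAt_norm_rpow hxη γ k).comp x (contDiffAt_id.add contDiffAt_const))
  have hσcont : Continuous σ := by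
    have hnorm : Continuous fun x : EuclideanSpace ℝ (Fin n) => ‖x‖ ^ γ :=
      continuous_norm.rpow_const fun _ => Or.inr hγ0.le
    exact (hnorm.add continuous_const).sub (hnorm.comp (continuous_id.add continuous_const))
  set U : Set (EuclideanSpace ℝ (Fin n)) := {x | x ≠ 0 ∧ x + η ≠ 0 ∧ 0 < f x}
  have hU : IsOpen U := isOpen_ne.inter
    ((isOpen_ne_fun (continuous_id.add continuous_const) continuous_const).inter
      (isOpen_lt continuous_const (hσcont.const_smul _)))
  have hξU : ξ ∈ U :=
    ⟨norm_pos_iff.1 hξ, norm_pos_iff.1 (hξ.trans_le hξη), by linarith⟩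
  have hg : ContDiffOn ℝ k (fun s : ℝ => s ^ (-(m : ℤ))) (Ioi 0) := fun s hs =>
    by
    simp only [zpow_neg, zpow_natCast]
    exact ((contDiffAt_id.pow m).inv (pow_ne_zero m (ne_of_gt hs))).contDiffWithinAt
  have hfdiff : ContDiffOn ℝ k f U := fun x hx =>
    ((hσdiff x hx.1 hx.2.1).const_smul (r ^ γ)⁻¹).contDiffWithinAt
  have hfD : ∀ i, 1 ≤ i → i ≤ k → ‖iteratedFDeriv ℝ i f ξ‖ ≤ (D / r) ^ i := fun i hi hik => by
    rw [hf, iteratedFDeriv_const_smul_apply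
      ((hσdiff ξ hξU.1 hξU.2.1).of_le (by exact_mod_cast hik)), norm_smul, Real.norm_of_nonneg (by positivity)]
    calc (r ^ γ)⁻¹ * ‖iteratedFDeriv ℝ i σ ξ‖ ≤ (r ^ γ)⁻¹ * (M i * r ^ (γ - i)) := by
          gcongr
          exact hM i ξ η hi hξ hξη
      _ = M i / r ^ i := by
          rw [Real.rpow_sub hξ, Real.rpow_natCast]
          field_simp
      _ ≤ (D / r) ^ i := by
          rw [div_pow]
          gcongr
          exact hD i hi hik
  have hcomp : ‖iteratedFDeriv ℝ k ((fun s : ℝ => s ^ (-(m : ℤ))) ∘ f) ξ‖ ≤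
      k.factorial * C * (D / r) ^ k := by
    rw [← iteratedFDerivWithin_of_isOpen k hU hξU]
    refine norm_iteratedFDerivWithin_comp_le hg hfdiff le_rfl isOpen_Ioi.uniqueDiffOn
      hU.uniqueDiffOn (fun x hx => hx.2.2) hξU (fun i hi => ?_) fun i hi hik => ?_
    · rw [iteratedFDerivWithin_of_isOpen i isOpen_Ioi (mem_Ioi.2 hξU.2.2)]
      exact hC _ hfξ i hi
    · rw [iteratedFDerivWithin_of_isOpen i hU hξU]
      exact hfD i hi hik
  have hfun : (fun x => σ x ^ (-(m : ℤ))) =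
      (r ^ γ) ^ (-(m : ℤ)) • ((fun s : ℝ => s ^ (-(m : ℤ))) ∘ f) := by
    ext x
    simp only [hf, Pi.smul_apply, Function.comp, smul_eq_mul]
    rw [← mul_zpow, mul_inv_cancel_left₀ hrγ.ne']
  have hcompdiff : ContDiffAt ℝ k ((fun s : ℝ => s ^ (-(m : ℤ))) ∘ f) ξ :=
    (hg.comp hfdiff fun x hx => hx.2.2).contDiffAt (hU.mem_nhds hξU)
  change ‖iteratedFDeriv ℝ k (fun x => σ x ^ (-(m : ℤ))) ξ‖ ≤ _
  rw [hfun, iteratedFDeriv_const_smul_apply hcompdiff, norm_smul,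
    Real.norm_of_nonneg (by positivity)]
  calc _ ≤ (r ^ γ) ^ (-(m : ℤ)) * (k.factorial * C * (D / r) ^ k) := by gcongr
    _ = _ := by
      rw [Real.rpow_sub hξ, Real.rpow_natCast, neg_mul, Real.rpow_neg hξ.le, mul_comm (m : ℝ),
        Real.rpow_mul hξ.le, Real.rpow_natCast, zpow_neg, zpow_natCast, div_pow]
      ring
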